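/- arXiv:2010.03697 — 3 statements merged into one kernel-verified Lean document; each statement's English description precedes it below -/
import Mathlib

section
/- Let d, N be positive integers, τ > 0, λ > 0, and let θ : ℝ^{N×N} → ℝ be bounded below. Define F(Z,C) = (1/2)‖ZC − Z‖_F² + λθ(C). Then the infimum of F(Z,C) over all C ∈ ℝ^{N×N} and all Z ∈ ℝ^{d×N} whose every row Z^i satisfies ‖Z^i‖² ≥ τ/d equals the infimum over C ∈ ℝ^{N×N} of (τ/2)·μ_min((C−I)(C−I)ᵀ) + λθ(C), where μ_min(M) denotes the smallest eigenvalue of the real symmetric positive semidefinite matrix M and I is the N×N identity matrix. -/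
open Matrix

/-- Squared Frobenius norm. -/
noncomputable def frobSq {m n : ℕ} (A : Matrix (Fin m) (Fin n) ℝ) : ℝ :=
  ∑ i, ∑ j, A i j ^ 2

/-- Smallest eigenvalue of a matrix, as the infimum of its set of (real) eigenvalues. -/
noncomputable def muMin {N : ℕ} (M : Matrix (Fin N) (Fin N) ℝ) : ℝ :=
  sInf {t : ℝ | ∃ v : Fin N → ℝ, v ≠ 0 ∧ M.mulVec v = t • v}

/-- The eigenvalue set of a symmetric real matrix of positive size attains its infimum. -/
theorem exists_eigenvector_muMin {N : ℕ} (hN : 0 < N) {M : Matrix (Fin N) (Fin N) ℝ}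
    (hM : M.IsHermitian) : ∃ v : Fin N → ℝ, v ≠ 0 ∧ M *ᵥ v = muMin M • v := by
  have hfin : {t : ℝ | ∃ v : Fin N → ℝ, v ≠ 0 ∧ M *ᵥ v = t • v}.Finite := by
    refine (Module.End.finite_hasEigenvalue (Matrix.toLin' M)).subset ?_
    rintro t ⟨v, hv, h⟩
    exact Module.End.hasEigenvalue_of_hasEigenvector
      (x := v) ⟨Module.End.mem_eigenspace_iff.2 (by simpa using h), hv⟩
  have hne : {t : ℝ | ∃ v : Fin N → ℝ, v ≠ 0 ∧ M *ᵥ v = t • v}.Nonempty := by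
    refine ⟨hM.eigenvalues ⟨0, hN⟩, WithLp.ofLp (hM.eigenvectorBasis ⟨0, hN⟩), ?_,
      hM.mulVec_eigenvectorBasis _⟩
    intro h
    exact hM.eigenvectorBasis.orthonormal.ne_zero ⟨0, hN⟩ (by ext i; exact congrFun h i)
  exact hne.csInf_mem hfin

/-- A lower bound for the eigenvalues of a symmetric real matrix bounds its quadratic form. -/
theorem mul_dotProduct_le_of_le_eigenvalues {N : ℕ} {M : Matrix (Fin N) (Fin N) ℝ}
    (hM : M.IsHermitian) {m : ℝ}
    (hm : ∀ t : ℝ, ∀ v : Fin N → ℝ, v ≠ 0 → M *ᵥ v = t • v → m ≤ t) (w : Fin N → ℝ) :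
    m * (w ⬝ᵥ w) ≤ w ⬝ᵥ (M *ᵥ w) := by
  have hA : (M - m • (1 : Matrix (Fin N) (Fin N) ℝ)).IsHermitian := by
    refine hM.sub ?_
    simp [Matrix.IsHermitian]
  have hpos : (M - m • (1 : Matrix (Fin N) (Fin N) ℝ)).PosSemidef := by
    refine hA.posSemidef_iff_eigenvalues_nonneg.2 fun i => ?_
    have h := hA.mulVec_eigenvectorBasis i
    have hle := hm (hA.eigenvalues i + m) (WithLp.ofLp (hA.eigenvectorBasis i))
      (fun h0 => hA.eigenvectorBasis.orthonormal.ne_zero i (by ext k; exact congrFun h0 k))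
      (by
        rw [Matrix.sub_mulVec, Matrix.smul_mulVec, Matrix.one_mulVec] at h
        rw [add_smul, ← h, sub_add_cancel])
    simpa using hle
  have h := hpos.dotProduct_mulVec_nonneg w
  simp only [star_trivial, Matrix.sub_mulVec, Matrix.smul_mulVec, Matrix.one_mulVec,
    dotProduct_sub, dotProduct_smul, smul_eq_mul] at h
  linarith

theorem nonneg_of_mulVec_mul_transpose_eq_smul {N : ℕ} (B : Matrix (Fin N) (Fin N) ℝ) {t : ℝ}
    {v : Fin N → ℝ} (hv : v ≠ 0) (h : (B * Bᵀ) *ᵥ v = t • v) : 0 ≤ t := by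
  have hpos := (Matrix.posSemidef_self_mul_conjTranspose B).dotProduct_mulVec_nonneg v
  rw [Matrix.conjTranspose_eq_transpose_of_trivial, h] at hpos
  simp only [star_trivial, dotProduct_smul, smul_eq_mul] at hpos
  have hvv : 0 < v ⬝ᵥ v := by simpa using Matrix.dotProduct_star_self_pos_iff.2 hv
  exact nonneg_of_mul_nonneg_left hpos hvv

theorem muMin_mul_transpose_nonneg {N : ℕ} (B : Matrix (Fin N) (Fin N) ℝ) :
    0 ≤ muMin (B * Bᵀ) :=
  Real.sInf_nonneg fun _ ⟨_, hv, h⟩ => nonneg_of_mulVec_mul_transpose_eq_smul B hv h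

theorem muMin_mul_transpose_le_rayleigh {N : ℕ} (B : Matrix (Fin N) (Fin N) ℝ) (w : Fin N → ℝ) :
    muMin (B * Bᵀ) * (w ⬝ᵥ w) ≤ w ⬝ᵥ ((B * Bᵀ) *ᵥ w) := by
  have hbdd : BddBelow {t : ℝ | ∃ v : Fin N → ℝ, v ≠ 0 ∧ (B * Bᵀ) *ᵥ v = t • v} :=
    ⟨0, fun _ ⟨_, hv, h⟩ => nonneg_of_mulVec_mul_transpose_eq_smul B hv h⟩
  exact mul_dotProduct_le_of_le_eigenvalues (Matrix.isHermitian_mul_conjTranspose_self B)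
    (fun _ v hv h => csInf_le hbdd ⟨v, hv, h⟩) w

theorem frobSq_mul {d N : ℕ} (Z : Matrix (Fin d) (Fin N) ℝ) (B : Matrix (Fin N) (Fin N) ℝ) :
    frobSq (Z * B) = ∑ i, Z i ⬝ᵥ ((B * Bᵀ) *ᵥ Z i) := by
  refine Finset.sum_congr rfl fun i _ => ?_
  rw [← Matrix.mulVec_mulVec, Matrix.dotProduct_mulVec, Matrix.mulVec_transpose]
  simp only [dotProduct, sq]
  rfl

/-- Every feasible `Z` costs at least the minimal eigenvalue. -/
theorem mul_muMin_le_frobSq_mul {d N : ℕ} (hd : 0 < d) {τ : ℝ}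
    (Z : Matrix (Fin d) (Fin N) ℝ) (B : Matrix (Fin N) (Fin N) ℝ)
    (hZ : ∀ i, τ / (d : ℝ) ≤ ∑ j, Z i j ^ 2) :
    τ * muMin (B * Bᵀ) ≤ frobSq (Z * B) := by
  have hd' : (d : ℝ) ≠ 0 := by positivity
  calc τ * muMin (B * Bᵀ) = ∑ _i : Fin d, muMin (B * Bᵀ) * (τ / d) := by
        simp only [Finset.sum_const, Finset.card_univ, Fintype.card_fin, nsmul_eq_mul]
        field_simp
    _ ≤ ∑ i, Z i ⬝ᵥ ((B * Bᵀ) *ᵥ Z i) := by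
        refine Finset.sum_le_sum fun i _ => le_trans ?_ (muMin_mul_transpose_le_rayleigh B (Z i))
        refine mul_le_mul_of_nonneg_left ?_ (muMin_mul_transpose_nonneg B)
        simpa only [dotProduct, sq] using hZ i
    _ = frobSq (Z * B) := (frobSq_mul Z B).symm

/-- The minimal eigenvalue is attained by a feasible `Z` with all rows equal. -/
theorem exists_frobSq_mul_eq {d N : ℕ} (hd : 0 < d) (hN : 0 < N) {τ : ℝ} (hτ : 0 < τ)
    (B : Matrix (Fin N) (Fin N) ℝ) :
    ∃ Z : Matrix (Fin d) (Fin N) ℝ, (∀ i, τ / (d : ℝ) ≤ ∑ j, Z i j ^ 2) ∧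
      frobSq (Z * B) = τ * muMin (B * Bᵀ) := by
  have hd' : (d : ℝ) ≠ 0 := by positivity
  obtain ⟨v, hv, h⟩ := exists_eigenvector_muMin hN (Matrix.isHermitian_mul_conjTranspose_self B)
  rw [Matrix.conjTranspose_eq_transpose_of_trivial] at h
  have hvv : 0 < v ⬝ᵥ v := by simpa using Matrix.dotProduct_star_self_pos_iff.2 hv
  obtain ⟨c, hc⟩ : ∃ c : ℝ, c * c = τ / d / (v ⬝ᵥ v) :=
    ⟨√(τ / d / (v ⬝ᵥ v)), Real.mul_self_sqrt (by positivity)⟩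
  have hnorm : (c • v) ⬝ᵥ (c • v) = τ / d := by
    rw [smul_dotProduct, dotProduct_smul, smul_eq_mul, smul_eq_mul, ← mul_assoc, hc]
    field_simp
  obtain ⟨Z, hZ⟩ : ∃ Z : Matrix (Fin d) (Fin N) ℝ, ∀ i, Z i = c • v :=
    ⟨Matrix.of fun _ => c • v, fun _ => rfl⟩
  refine ⟨Z, fun i => ?_, ?_⟩
  · rw [← hnorm, hZ]
    simp only [dotProduct, sq, le_refl]
  · rw [frobSq_mul]
    simp only [hZ, Matrix.mulVec_smul, h, smul_comm c (muMin (B * Bᵀ)) v]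
    simp only [dotProduct_smul _ _ (c • v), hnorm, smul_eq_mul, Finset.sum_const,
      Finset.card_univ, Fintype.card_fin, nsmul_eq_mul]
    field_simp

theorem stmt4 (d N : ℕ) (hd : 0 < d) (hN : 0 < N) (τ lam : ℝ) (hτ : 0 < τ) (hlam : 0 < lam)
    (θ : Matrix (Fin N) (Fin N) ℝ → ℝ) (hθ : BddBelow (Set.range θ)) :
    sInf {y : ℝ | ∃ (C : Matrix (Fin N) (Fin N) ℝ) (Z : Matrix (Fin d) (Fin N) ℝ),
        (∀ i, τ / (d : ℝ) ≤ ∑ j, Z i j ^ 2) ∧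
        y = (1 / 2) * frobSq (Z * C - Z) + lam * θ C} =
    sInf {y : ℝ | ∃ C : Matrix (Fin N) (Fin N) ℝ,
        y = (τ / 2) * muMin ((C - 1) * (C - 1)ᵀ) + lam * θ C} := by
  have hsub (C : Matrix (Fin N) (Fin N) ℝ) (Z : Matrix (Fin d) (Fin N) ℝ) :
      Z * C - Z = Z * (C - 1) := by rw [Matrix.mul_sub, Matrix.mul_one]
  obtain ⟨b, hb⟩ := hθ
  have hbC (C : Matrix (Fin N) (Fin N) ℝ) : lam * b ≤ lam * θ C :=
    mul_le_mul_of_nonneg_left (hb ⟨C, rfl⟩) hlam.le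
  have hmem (C : Matrix (Fin N) (Fin N) ℝ) :
      ∃ Z : Matrix (Fin d) (Fin N) ℝ, (∀ i, τ / (d : ℝ) ≤ ∑ j, Z i j ^ 2) ∧
        (τ / 2) * muMin ((C - 1) * (C - 1)ᵀ) + lam * θ C =
          (1 / 2) * frobSq (Z * C - Z) + lam * θ C := by
    obtain ⟨Z, hZ, h⟩ := exists_frobSq_mul_eq hd hN hτ (C - 1)
    exact ⟨Z, hZ, by rw [hsub, h]; ring⟩
  apply le_antisymm
  · refine csInf_le_csInf ⟨lam * b, ?_⟩ ⟨_, 0, rfl⟩ ?_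
    · rintro y ⟨C, Z, -, rfl⟩
      have hnn : 0 ≤ frobSq (Z * C - Z) :=
        Finset.sum_nonneg fun i _ => Finset.sum_nonneg fun j _ => sq_nonneg _
      linarith [hbC C]
    · rintro y ⟨C, rfl⟩
      exact ⟨C, hmem C⟩
  · obtain ⟨Z₀, hZ₀⟩ := hmem 0
    refine le_csInf ⟨_, 0, Z₀, hZ₀.1, rfl⟩ ?_
    rintro y ⟨C, Z, hZ, rfl⟩
    refine csInf_le_of_le ⟨lam * b, ?_⟩ ⟨C, rfl⟩ ?_
    · rintro y ⟨C', rfl⟩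
      have hnn := mul_nonneg hτ.le (muMin_mul_transpose_nonneg (C' - 1))
      linarith [hbC C']
    · have hle := mul_muMin_le_frobSq_mul hd Z (C - 1) hZ
      rw [hsub]
      linarith
end

section
/- Let d, N ≥ 2 and τ > 0. Consider the problem of minimizing ‖C‖₁ over all pairs (Z, C) with Z ∈ ℝ^{d×N}, C ∈ ℝ^{N×N}, subject to: all diagonal entries of C are zero, Z = ZC, and every row Z^i of Z satisfies ‖Z^i‖² ≥ τ/d. The optimal value is 2, and a feasible pair (Z, C) is optimal if and only if there exist distinct indices i ≠ j, a sign s ∈ {−1, 1}, and a vector z ∈ ℝ^d with z_k² ≥ τ/(2d) for every coordinate k, such that: column Z_i = z, column Z_j = s·z, all other columns of Z are zero, C_{i,j} = C_{j,i} = s, and all other entries of C are zero. -/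
open Matrix

/-- Entrywise ℓ1 norm of a matrix. -/
noncomputable def l1 {m n : ℕ} (A : Matrix (Fin m) (Fin n) ℝ) : ℝ :=
  ∑ i, ∑ j, |A i j|

/-- A matrix supported on two distinct transposed positions, with entries of absolute value one,
has entrywise ℓ1 norm `2`. -/
theorem l1_eq_two_of_support {N : ℕ} {C : Matrix (Fin N) (Fin N) ℝ} {i j : Fin N} (hij : i ≠ j)
    (h₁ : |C i j| = 1) (h₂ : |C j i| = 1)
    (h₀ : ∀ a b, ¬(a = i ∧ b = j) → ¬(a = j ∧ b = i) → C a b = 0) : l1 C = 2 := by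
  have hi : ∑ b, |C i b| = 1 := by
    rw [Fintype.sum_eq_single j, h₁]
    intro b hb
    rw [h₀ i b (fun h => hb h.2) (fun h => hij h.1), abs_zero]
  have hj : ∑ b, |C j b| = 1 := by
    rw [Fintype.sum_eq_single i, h₂]
    intro b hb
    rw [h₀ j b (fun h => hij h.1.symm) (fun h => hb h.2), abs_zero]
  rw [l1, Fintype.sum_eq_add i j hij, hi, hj]
  · norm_num
  · rintro a ⟨hai, haj⟩
    refine Finset.sum_eq_zero fun b _ => ?_
    rw [h₀ a b (fun h => hai h.1) (fun h => haj h.1), abs_zero]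

/-- A coordinate of a fixed row vector of a hollow matrix is bounded by the largest of the other
coordinates times the corresponding absolute column sum. -/
theorem abs_apply_le_mul_colSum {N : ℕ} {C : Matrix (Fin N) (Fin N) ℝ} {x : Fin N → ℝ}
    {b : Fin N} {m : ℝ} (hC : C b b = 0) (hx : x b = ∑ a, x a * C a b)
    (hm : ∀ a, a ≠ b → |x a| ≤ m) : |x b| ≤ m * ∑ a, |C a b| := by
  rw [Finset.mul_sum]
  calc |x b| = |∑ a, x a * C a b| := by rw [← hx]
    _ ≤ ∑ a, |x a * C a b| := Finset.abs_sum_le_sum_abs _ _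
    _ ≤ ∑ a, m * |C a b| := by
      refine Finset.sum_le_sum fun a _ => ?_
      rw [abs_mul]
      rcases eq_or_ne a b with rfl | hab
      · simp [hC]
      · exact mul_le_mul_of_nonneg_right (hm a hab) (abs_nonneg _)

/-- If a hollow matrix fixes a nonzero row vector, then two of its absolute column sums have
product at least one, and they equal one only if the corresponding coordinates have equal
absolute value. -/
theorem exists_one_le_colSum_mul_colSum {N : ℕ} (hN : 2 ≤ N) {C : Matrix (Fin N) (Fin N) ℝ}
    {x : Fin N → ℝ} (hC : ∀ i, C i i = 0) (hx : ∀ b, x b = ∑ a, x a * C a b)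
    (hx₀ : ∃ b, x b ≠ 0) :
    ∃ p q, p ≠ q ∧ x p ≠ 0 ∧ 1 ≤ (∑ a, |C a p|) * ∑ a, |C a q| ∧
      (∑ a, |C a p| = 1 → ∑ a, |C a q| = 1 → |x p| = |x q|) := by
  obtain ⟨b₀, hb₀⟩ := hx₀
  obtain ⟨p, -, hp⟩ := Finset.exists_max_image Finset.univ (fun b => |x b|) ⟨b₀, Finset.mem_univ _⟩
  have : Nontrivial (Fin N) := Fin.nontrivial_iff_two_le.mpr hN
  obtain ⟨r, hr⟩ := exists_ne p
  obtain ⟨q, hqp, hq⟩ := Finset.exists_max_image (Finset.univ.erase p) (fun b => |x b|)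
    ⟨r, Finset.mem_erase.mpr ⟨hr, Finset.mem_univ _⟩⟩
  have hp_pos : 0 < |x p| := (abs_pos.mpr hb₀).trans_le (hp b₀ (Finset.mem_univ _))
  have hpS : |x p| ≤ |x q| * ∑ a, |C a p| := abs_apply_le_mul_colSum (hC p) (hx p)
    fun a ha => hq a (Finset.mem_erase.mpr ⟨ha, Finset.mem_univ _⟩)
  have hqS : |x q| ≤ |x p| * ∑ a, |C a q| := abs_apply_le_mul_colSum (hC q) (hx q)
    fun a _ => hp a (Finset.mem_univ _)
  have hS : 0 ≤ ∑ a, |C a p| := Finset.sum_nonneg fun a _ => abs_nonneg _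
  refine ⟨p, q, (Finset.ne_of_mem_erase hqp).symm, abs_pos.mp hp_pos, ?_, fun h₁ h₂ => ?_⟩
  · refine le_of_mul_le_mul_left ?_ hp_pos
    nlinarith [mul_le_mul_of_nonneg_right hqS hS]
  · rw [h₁, mul_one] at hpS
    rw [h₂, mul_one] at hqS
    exact le_antisymm hpS hqS

theorem l1_eq_sum_colSum {m n : ℕ} (A : Matrix (Fin m) (Fin n) ℝ) :
    l1 A = ∑ j, ∑ i, |A i j| :=
  Finset.sum_comm

theorem colSum_add_colSum_le_l1 {m n : ℕ} (A : Matrix (Fin m) (Fin n) ℝ) {p q : Fin n}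
    (hpq : p ≠ q) : ∑ i, |A i p| + ∑ i, |A i q| ≤ l1 A := by
  rw [l1_eq_sum_colSum, ← Finset.sum_pair (f := fun j => ∑ i, |A i j|) hpq]
  exact Finset.sum_le_sum_of_subset_of_nonneg (Finset.subset_univ _)
    fun _ _ _ => Finset.sum_nonneg fun _ _ => abs_nonneg _

/-- The columns outside a pair that exhausts the entrywise ℓ1 norm vanish. -/
theorem apply_eq_zero_of_l1_le {m n : ℕ} {A : Matrix (Fin m) (Fin n) ℝ} {p q : Fin n}
    (hpq : p ≠ q) (h : l1 A ≤ ∑ i, |A i p| + ∑ i, |A i q|) {l : Fin n} (hlp : l ≠ p)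
    (hlq : l ≠ q) (i : Fin m) : A i l = 0 := by
  have hsub : ∑ j ∈ {l, p, q}, ∑ i, |A i j| ≤ l1 A := by
    rw [l1_eq_sum_colSum]
    exact Finset.sum_le_sum_of_subset_of_nonneg (Finset.subset_univ _)
      fun _ _ _ => Finset.sum_nonneg fun _ _ => abs_nonneg _
  rw [Finset.sum_insert (by simp [hlp, hlq]), Finset.sum_pair hpq] at hsub
  have hle : |A i l| ≤ ∑ i, |A i l| :=
    Finset.single_le_sum (f := fun i => |A i l|) (fun _ _ => abs_nonneg _) (Finset.mem_univ i)
  exact abs_nonpos_iff.mp (by linarith)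

/-- If one entry of a vector carries its whole ℓ1 norm, then the other entries vanish. -/
theorem eq_zero_of_sum_abs_le {n : ℕ} {v : Fin n → ℝ} {p : Fin n} (h : ∑ i, |v i| ≤ |v p|)
    {a : Fin n} (ha : a ≠ p) : v a = 0 := by
  have hsub : ∑ i ∈ {a, p}, |v i| ≤ ∑ i, |v i| :=
    Finset.sum_le_sum_of_subset_of_nonneg (Finset.subset_univ _) fun _ _ _ => abs_nonneg _
  rw [Finset.sum_pair ha] at hsub
  exact abs_nonpos_iff.mp (by linarith)

theorem two_le_add_of_one_le_mul {s t : ℝ} (hs : 0 ≤ s) (ht : 0 ≤ t) (h : 1 ≤ s * t) :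
    2 ≤ s + t := by
  nlinarith [sq_nonneg (s - t)]

/-- A hollow matrix of entrywise ℓ1 norm at most `2` fixing a nonzero row vector `x` is, up to a
common sign, the adjacency matrix of a single edge. -/
theorem exists_pair_of_l1_le_two {N : ℕ} (hN : 2 ≤ N) {C : Matrix (Fin N) (Fin N) ℝ}
    {x : Fin N → ℝ} (hC : ∀ i, C i i = 0) (hx : ∀ b, x b = ∑ a, x a * C a b)
    (hx₀ : ∃ b, x b ≠ 0) (hl : l1 C ≤ 2) :
    ∃ (p q : Fin N) (s : ℝ), p ≠ q ∧ (s = 1 ∨ s = -1) ∧ C p q = s ∧ C q p = s ∧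
      ∀ a b, ¬(a = p ∧ b = q) → ¬(a = q ∧ b = p) → C a b = 0 := by
  obtain ⟨p, q, hpq, hp, hmul, heq⟩ := exists_one_le_colSum_mul_colSum hN hC hx hx₀
  have hle := colSum_add_colSum_le_l1 C hpq
  set S := ∑ a, |C a p| with hS
  set T := ∑ a, |C a q| with hT
  have hST : S = T := by
    have : (S - T) ^ 2 ≤ 0 := by
      have : 0 ≤ S + T := add_nonneg (Finset.sum_nonneg fun _ _ => abs_nonneg _)
        (Finset.sum_nonneg fun _ _ => abs_nonneg _)
      nlinarith
    nlinarith [pow_eq_zero_iff (two_ne_zero) |>.mp (le_antisymm this (sq_nonneg _))]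
  have hS1 : S = 1 := by
    have : 0 ≤ S := Finset.sum_nonneg fun _ _ => abs_nonneg _
    rw [← hST] at hmul hle
    nlinarith
  have hT1 : T = 1 := hST ▸ hS1
  have hother : ∀ l, l ≠ p → l ≠ q → ∀ a, C a l = 0 := fun l hlp hlq a =>
    apply_eq_zero_of_l1_le hpq (by rw [← hS, ← hT]; linarith) hlp hlq a
  have hx_other : ∀ l, l ≠ p → l ≠ q → x l = 0 := fun l hlp hlq => by
    rw [hx l]
    exact Finset.sum_eq_zero fun a _ => by rw [hother l hlp hlq a, mul_zero]
  have hxp : x p = x q * C q p := by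
    rw [hx p, Fintype.sum_eq_single q]
    intro a ha
    rcases eq_or_ne a p with rfl | hap
    · rw [hC, mul_zero]
    · rw [hx_other a hap ha, zero_mul]
  have hxq : x q = x p * C p q := by
    rw [hx q, Fintype.sum_eq_single p]
    intro a ha
    rcases eq_or_ne a q with rfl | haq
    · rw [hC, mul_zero]
    · rw [hx_other a ha haq, zero_mul]
  have habs := heq hS1 hT1
  have hpq1 : |C p q| = 1 := by
    have h := congrArg abs hxq
    rw [abs_mul, ← habs] at h
    exact (mul_eq_left₀ (abs_ne_zero.mpr hp)).mp h.symm
  have hmul1 : C p q * C q p = 1 := by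
    rw [hxq, mul_assoc] at hxp
    exact (mul_eq_left₀ hp).mp hxp.symm
  have hs : C p q = 1 ∨ C p q = -1 := (abs_eq zero_le_one).mp hpq1
  have hqp : C q p = C p q := by
    rcases hs with h | h <;> rw [h] at hmul1 ⊢ <;> linarith
  refine ⟨p, q, C p q, hpq, hs, rfl, hqp, fun a b hab hba => ?_⟩
  rcases eq_or_ne b p with rfl | hbp
  · exact eq_zero_of_sum_abs_le (v := fun a => C a b) (p := q)
      (by rw [← hS, hS1, hqp, hpq1]) (fun h => hba ⟨h, rfl⟩)
  · rcases eq_or_ne b q with rfl | hbq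
    · exact eq_zero_of_sum_abs_le (v := fun a => C a b) (p := p)
        (by rw [← hT, hT1, hpq1]) (fun h => hab ⟨h, rfl⟩)
    · exact hother b hbp hbq a

/-- The optimal value is attained by two equal nonzero columns. -/
theorem exists_feasible_l1_eq_two {d N : ℕ} (hN : 2 ≤ N) {t : ℝ} (ht : 0 ≤ t) :
    ∃ (Z : Matrix (Fin d) (Fin N) ℝ) (C : Matrix (Fin N) (Fin N) ℝ),
      (∀ i, C i i = 0) ∧ Z = Z * C ∧ (∀ i, t ≤ ∑ j, Z i j ^ 2) ∧ 2 = l1 C := by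
  have : Nontrivial (Fin N) := Fin.nontrivial_iff_two_le.mpr hN
  obtain ⟨p, q, hpq⟩ := exists_pair_ne (Fin N)
  refine ⟨of fun _ l => if l = p ∨ l = q then √t else 0,
    of fun a b => if (a = p ∧ b = q) ∨ (a = q ∧ b = p) then 1 else 0, ?_, ?_, ?_, ?_⟩
  · intro i
    simp only [of_apply, ite_eq_right_iff, one_ne_zero]
    rintro (⟨rfl, h⟩ | ⟨rfl, h⟩)
    exacts [hpq h, hpq h.symm]
  · ext k b
    simp only [mul_apply, of_apply]
    rcases eq_or_ne b p with rfl | hbp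
    · simp [hpq]
    · rcases eq_or_ne b q with rfl | hbq
      · simp [hpq.symm]
      · simp [hbp, hbq]
  · intro k
    refine le_trans ?_ (Finset.single_le_sum (fun _ _ => sq_nonneg _) (Finset.mem_univ p))
    simp [Real.sq_sqrt ht]
  · refine (l1_eq_two_of_support hpq (by simp) (by simp) fun a b hab hba => ?_).symm
    simp only [of_apply, ite_eq_right_iff, one_ne_zero]
    exact fun h => h.elim hab hba

theorem stmt10 (d N : ℕ) (hd : 2 ≤ d) (hN : 2 ≤ N) (τ : ℝ) (hτ : 0 < τ) :
    IsLeast {y : ℝ | ∃ (Z : Matrix (Fin d) (Fin N) ℝ) (C : Matrix (Fin N) (Fin N) ℝ),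
        (∀ i, C i i = 0) ∧ Z = Z * C ∧ (∀ i, τ / (d : ℝ) ≤ ∑ j, Z i j ^ 2) ∧ y = l1 C} 2 ∧
    ∀ (Z : Matrix (Fin d) (Fin N) ℝ) (C : Matrix (Fin N) (Fin N) ℝ),
      (∀ i, C i i = 0) → Z = Z * C → (∀ i, τ / (d : ℝ) ≤ ∑ j, Z i j ^ 2) →
      (l1 C = 2 ↔
        ∃ (i j : Fin N) (s : ℝ) (z : Fin d → ℝ),
          i ≠ j ∧ (s = 1 ∨ s = -1) ∧ (∀ k, τ / (2 * (d : ℝ)) ≤ z k ^ 2) ∧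
          (∀ k, Z k i = z k) ∧ (∀ k, Z k j = s * z k) ∧
          (∀ l, l ≠ i → l ≠ j → ∀ k, Z k l = 0) ∧
          C i j = s ∧ C j i = s ∧
          (∀ a b, ¬(a = i ∧ b = j) → ¬(a = j ∧ b = i) → C a b = 0)) := by
  have hd₀ : (0 : ℝ) < d := by exact_mod_cast (by omega : 0 < d)
  have hpos : 0 < τ / (d : ℝ) := div_pos hτ hd₀
  have hrow : ∀ {Z : Matrix (Fin d) (Fin N) ℝ} {C : Matrix (Fin N) (Fin N) ℝ}, Z = Z * C →
      ∀ k b, Z k b = ∑ a, Z k a * C a b := fun hZ k b => by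
    rw [← mul_apply, ← hZ]
  have hne : ∀ {Z : Matrix (Fin d) (Fin N) ℝ}, (∀ i, τ / (d : ℝ) ≤ ∑ j, Z i j ^ 2) →
      ∀ k, ∃ b, Z k b ≠ 0 := fun hZ k => by
    by_contra! h
    have := hZ k
    simp only [h] at this
    norm_num at this
    linarith
  refine ⟨⟨exists_feasible_l1_eq_two hN hpos.le, ?_⟩, fun Z C hC hZ hτZ => ⟨fun hl => ?_, ?_⟩⟩
  · rintro _ ⟨Z, C, hC, hZ, hτZ, rfl⟩
    obtain ⟨p, q, hpq, -, hmul, -⟩ := exists_one_le_colSum_mul_colSum hN hC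
      (hrow hZ ⟨0, by omega⟩) (hne hτZ _)
    exact (two_le_add_of_one_le_mul (Finset.sum_nonneg fun _ _ => abs_nonneg _)
      (Finset.sum_nonneg fun _ _ => abs_nonneg _) hmul).trans (colSum_add_colSum_le_l1 C hpq)
  · obtain ⟨p, q, s, hpq, hs, hCpq, hCqp, h₀⟩ := exists_pair_of_l1_le_two hN hC
      (hrow hZ ⟨0, by omega⟩) (hne hτZ _) hl.le
    have hZq : ∀ k, Z k q = s * Z k p := fun k => by
      rw [hrow hZ k q, Fintype.sum_eq_single p, hCpq, mul_comm]
      intro a ha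
      rw [h₀ a q (fun h => ha h.1) (fun h => hpq h.2.symm), mul_zero]
    have hZ₀ : ∀ l, l ≠ p → l ≠ q → ∀ k, Z k l = 0 := fun l hlp hlq k => by
      rw [hrow hZ k l]
      refine Finset.sum_eq_zero fun a _ => ?_
      rw [h₀ a l (fun h => hlq h.2) (fun h => hlp h.2), mul_zero]
    refine ⟨p, q, s, fun k => Z k p, hpq, hs, fun k => ?_, fun _ => rfl, hZq, hZ₀, hCpq, hCqp, h₀⟩
    have hk := hτZ k
    have hs2 : s ^ 2 = 1 := by rcases hs with rfl | rfl <;> norm_num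
    rw [Fintype.sum_eq_add p q hpq (fun l hl => by rw [hZ₀ l hl.1 hl.2 k, sq, mul_zero]),
      hZq, mul_pow, hs2, one_mul] at hk
    have : τ / (2 * (d : ℝ)) = τ / d / 2 := by rw [mul_comm, div_div]
    linarith
  · rintro ⟨i, j, s, -, hij, hs, -, -, -, -, hCij, hCji, h₀⟩
    have hs1 : |s| = 1 := (abs_eq zero_le_one).mpr hs
    exact l1_eq_two_of_support hij (hCij ▸ hs1) (hCji ▸ hs1) h₀
end

section
/- Let d, N be positive integers and τ > 0. Consider the problem of minimizing ‖C‖_F over all pairs (Z, C) with Z ∈ ℝ^{d×N}, C ∈ ℝ^{N×N}, subject to Z = ZC and every row Z^i of Z satisfying ‖Z^i‖² ≥ τ/d. The optimal value is 1, and a feasible pair (Z, C) is optimal if and only if there exist a unit vector q ∈ ℝ^N and a vector z ∈ ℝ^d with z_i² ≥ τ/d for every coordinate i, such that Z = z qᵀ and C = q qᵀ. -/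
open Matrix

/-- Frobenius norm. -/
noncomputable def frobNorm {m n : ℕ} (A : Matrix (Fin m) (Fin n) ℝ) : ℝ :=
  Real.sqrt (∑ i, ∑ j, A i j ^ 2)

/-- If a unit vector `q` is a left fixed vector of `C`, then `C - q qᵀ` is orthogonal to `q qᵀ`. -/
theorem sum_sq_sub_vecMulVec {N : ℕ} {C : Matrix (Fin N) (Fin N) ℝ} {q : Fin N → ℝ}
    (hC : q ᵥ* C = q) (hq : ∑ i, q i ^ 2 = 1) :
    ∑ i, ∑ j, (C i j - q i * q j) ^ 2 = (∑ i, ∑ j, C i j ^ 2) - 1 := by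
  have hcross : ∑ i, ∑ j, q i * C i j * q j = 1 := by
    rw [Finset.sum_comm, ← hq]
    refine Finset.sum_congr rfl fun j _ => ?_
    have hj : ∑ i, q i * C i j = q j := congrFun hC j
    rw [← Finset.sum_mul, hj, sq]
  have hqq : ∑ i, ∑ j, q i ^ 2 * q j ^ 2 = 1 := by
    rw [← Finset.sum_mul_sum, hq, one_mul]
  calc ∑ i, ∑ j, (C i j - q i * q j) ^ 2
      = ∑ i, ∑ j, (C i j ^ 2 - 2 * (q i * C i j * q j) + q i ^ 2 * q j ^ 2) :=
        Finset.sum_congr rfl fun i _ => Finset.sum_congr rfl fun j _ => by ring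
    _ = (∑ i, ∑ j, C i j ^ 2) - 1 := by
        simp only [Finset.sum_add_distrib, Finset.sum_sub_distrib, ← Finset.mul_sum]
        simp only [← Finset.mul_sum, hq] at hqq ⊢
        rw [hcross, hqq]
        ring

/-- A nonzero row of `Z = Z * C` normalizes to a unit left fixed vector of `C`. -/
theorem exists_unit_vecMul_eq {d N : ℕ} {Z : Matrix (Fin d) (Fin N) ℝ}
    {C : Matrix (Fin N) (Fin N) ℝ} (hZC : Z = Z * C) {i : Fin d} (hi : 0 < ∑ j, Z i j ^ 2) :
    ∃ q : Fin N → ℝ, q ᵥ* C = q ∧ ∑ j, q j ^ 2 = 1 := by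
  have hrow : Z i ᵥ* C = Z i := (congrFun hZC i).symm
  refine ⟨(√(∑ j, Z i j ^ 2))⁻¹ • Z i, by rw [Matrix.smul_vecMul, hrow], ?_⟩
  simp only [Pi.smul_apply, smul_eq_mul, mul_pow, ← Finset.mul_sum, inv_pow, Real.sq_sqrt hi.le]
  exact inv_mul_cancel₀ hi.ne'

theorem frobNorm_vecMulVec_self {N : ℕ} {q : Fin N → ℝ} (hq : ∑ i, q i ^ 2 = 1) :
    frobNorm (vecMulVec q q) = 1 := by
  simp only [frobNorm, vecMulVec_apply, mul_pow, ← Finset.mul_sum, hq, mul_one, Real.sqrt_one]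

theorem sum_sq_vecMulVec_row {d N : ℕ} (z : Fin d → ℝ) {q : Fin N → ℝ}
    (hq : ∑ i, q i ^ 2 = 1) (i : Fin d) : ∑ j, vecMulVec z q i j ^ 2 = z i ^ 2 := by
  simp only [vecMulVec_apply, mul_pow, ← Finset.mul_sum, hq, mul_one]

theorem vecMulVec_mul_vecMulVec_self {d N : ℕ} (z : Fin d → ℝ) {q : Fin N → ℝ}
    (hq : ∑ i, q i ^ 2 = 1) : vecMulVec z q * vecMulVec q q = vecMulVec z q := by
  have hqq : q ⬝ᵥ q = 1 := by simpa only [dotProduct, ← sq] using hq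
  rw [vecMulVec_mul_vecMulVec, hqq, one_smul]

theorem stmt13 (d N : ℕ) (hd : 0 < d) (hN : 0 < N) (τ : ℝ) (hτ : 0 < τ) :
    IsLeast {y : ℝ | ∃ (Z : Matrix (Fin d) (Fin N) ℝ) (C : Matrix (Fin N) (Fin N) ℝ),
        Z = Z * C ∧ (∀ i, τ / (d : ℝ) ≤ ∑ j, Z i j ^ 2) ∧ y = frobNorm C} 1 ∧
    ∀ (Z : Matrix (Fin d) (Fin N) ℝ) (C : Matrix (Fin N) (Fin N) ℝ),
      Z = Z * C → (∀ i, τ / (d : ℝ) ≤ ∑ j, Z i j ^ 2) →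
      (frobNorm C = 1 ↔
        ∃ (q : Fin N → ℝ) (z : Fin d → ℝ),
          (∑ i, q i ^ 2) = 1 ∧ (∀ i, τ / (d : ℝ) ≤ z i ^ 2) ∧
          Z = Matrix.vecMulVec z q ∧ C = Matrix.vecMulVec q q) := by
  have hpos : 0 < τ / (d : ℝ) := div_pos hτ (Nat.cast_pos.mpr hd)
  refine ⟨⟨?_, ?_⟩, ?_⟩
  · have hq : ∑ i, (Pi.single ⟨0, hN⟩ 1 : Fin N → ℝ) i ^ 2 = 1 := by
      simp [Pi.single_apply]
    refine ⟨vecMulVec (fun _ => √(τ / d)) (Pi.single ⟨0, hN⟩ 1), _,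
      (vecMulVec_mul_vecMulVec_self _ hq).symm, fun i => ?_, (frobNorm_vecMulVec_self hq).symm⟩
    rw [sum_sq_vecMulVec_row _ hq, Real.sq_sqrt hpos.le]
  · rintro _ ⟨Z, C, hZC, hZ, rfl⟩
    obtain ⟨q, hqC, hq⟩ := exists_unit_vecMul_eq hZC (hpos.trans_le (hZ ⟨0, hd⟩))
    rw [frobNorm, Real.one_le_sqrt, ← sub_nonneg, ← sum_sq_sub_vecMulVec hqC hq]
    positivity
  · intro Z C hZC hZ
    constructor
    · intro hC
      obtain ⟨q, hqC, hq⟩ := exists_unit_vecMul_eq hZC (hpos.trans_le (hZ ⟨0, hd⟩))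
      have hzero : ∑ i, ∑ j, (C i j - q i * q j) ^ 2 = 0 := by
        rw [sum_sq_sub_vecMulVec hqC hq, Real.sqrt_eq_one.mp hC, sub_self]
      have hCq : C = vecMulVec q q := by
        ext i j
        rw [Finset.sum_eq_zero_iff_of_nonneg fun i _ => by positivity] at hzero
        have hi := hzero i (Finset.mem_univ i)
        rw [Finset.sum_eq_zero_iff_of_nonneg fun j _ => by positivity] at hi
        exact sub_eq_zero.mp (pow_eq_zero_iff two_ne_zero |>.mp (hi j (Finset.mem_univ j)))
      have hZq : Z = vecMulVec (Z *ᵥ q) q := by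
        rw [← mul_vecMulVec, ← hCq]
        exact hZC
      refine ⟨q, Z *ᵥ q, hq, fun i => ?_, hZq, hCq⟩
      rw [← sum_sq_vecMulVec_row _ hq, ← hZq]
      exact hZ i
    · rintro ⟨q, z, hq, -, -, rfl⟩
      exact frobNorm_vecMulVec_self hq
end
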